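/- The discriminant group D(D₃) of the hermitian lattice D₃ is isomorphic, as a finite 𝔼-module with K/𝔼-valued hermitian form, to the finite hermitian space V = (𝔼/θ𝔼)² with form ((a₁,a₂),(b₁,b₂)) = (a₁·conj(b₂) − a₂·conj(b₁))·θ/3 (mod 𝔼). -/

import Mathlib

/- STATEMENT 4: The discriminant group D(D₃) = D₃^∨/D₃ of the hermitian lattice
D₃ = {x ∈ 𝔼³ : x₁+x₂+x₃ ≡ 0 mod θ𝔼} is isomorphic, as a finite 𝔼-module with
K/𝔼-valued hermitian form, to V = (𝔼/θ𝔼)² with form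
((a₁,a₂),(b₁,b₂)) = (a₁·conj(b₂) − a₂·conj(b₁))·θ/3 mod 𝔼.
The isomorphism is encoded at the level of representatives: a map φ : D₃^∨ → 𝔼²
which is additive and 𝔼-semilinear mod θ𝔼, sends D₃ to θ𝔼² (and only D₃),
is surjective mod θ𝔼², and carries the induced K/𝔼-valued form of D(D₃) to the
form of V. -/

noncomputable section

open Complex Matrix BigOperators

def ω : ℂ := Complex.exp (2 * Real.pi * Complex.I / 3)
def θ : ℂ := ω - ω ^ 2
def Eis : Set ℂ := {z : ℂ | ∃ a b : ℤ, z = (a : ℂ) + (b : ℂ) * ω}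
def thetaE : Set ℂ := {z : ℂ | ∃ w ∈ Eis, z = θ * w}

/-- The standard hermitian form on ℂ³. -/
def hermStd3 (x y : Fin 3 → ℂ) : ℂ := ∑ i, x i * star (y i)

/-- The lattice D₃. -/
def D3Set : Set (Fin 3 → ℂ) := {x | (∀ i, x i ∈ Eis) ∧ x 0 + x 1 + x 2 ∈ thetaE}

/-- The dual lattice D₃^∨. -/
def dualD3 : Set (Fin 3 → ℂ) := {v | ∀ w ∈ D3Set, hermStd3 v w ∈ Eis}

lemma ω_sq : ω ^ 2 = -1 - ω := by
  have hprim : IsPrimitiveRoot ω 3 := by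
    have h := Complex.isPrimitiveRoot_exp 3 (by norm_num)
    simpa [ω] using h
  have h := hprim.geom_sum_eq_zero (by norm_num)
  simp only [Finset.sum_range_succ, Finset.sum_range_zero] at h
  linear_combination h

lemma star_ω : star ω = -1 - ω := by
  have hc : star ω * ω = 1 := by
    change (starRingEnd ℂ) (Complex.exp _) * Complex.exp _ = 1
    rw [← Complex.exp_conj, ← Complex.exp_add]
    have h2 : (starRingEnd ℂ) 2 = 2 := map_ofNat _ 2
    have h3 : (starRingEnd ℂ) 3 = 3 := map_ofNat _ 3
    simp [h2, h3, neg_div]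
  have h := ω_sq
  linear_combination (-1 - ω) * hc + star ω * h

lemma θ_eq : θ = 1 + 2 * ω := by
  unfold θ
  linear_combination -ω_sq

lemma θ_sq : θ ^ 2 = -3 := by
  rw [θ_eq]
  linear_combination 4 * ω_sq

lemma star_θ : star θ = -θ := by
  rw [θ_eq, star_add, star_mul', star_ω]
  simp
  ring

lemma θ_ne_zero : θ ≠ 0 := by
  intro h
  have := θ_sq
  norm_num [h] at this

/-- The Eisenstein integers as a subring of `ℂ`. -/
def eisSubring : Subring ℂ where
  carrier := Eis
  zero_mem' := ⟨0, 0, by simp⟩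
  one_mem' := ⟨1, 0, by simp⟩
  add_mem' := by
    rintro _ _ ⟨a, b, rfl⟩ ⟨c, d, rfl⟩
    exact ⟨a + c, b + d, by push_cast; ring⟩
  neg_mem' := by
    rintro _ ⟨a, b, rfl⟩
    exact ⟨-a, -b, by push_cast; ring⟩
  mul_mem' := by
    rintro _ _ ⟨a, b, rfl⟩ ⟨c, d, rfl⟩
    refine ⟨a * c - b * d, a * d + b * c - b * d, ?_⟩
    push_cast
    linear_combination (b * d : ℂ) * ω_sq

lemma mem_eisSubring {z : ℂ} : z ∈ eisSubring ↔ z ∈ Eis := Iff.rfl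

lemma star_mem_eisSubring {z : ℂ} (hz : z ∈ eisSubring) : star z ∈ eisSubring := by
  obtain ⟨a, b, rfl⟩ := hz
  refine ⟨a - b, -b, ?_⟩
  rw [star_add, star_mul', star_ω]
  simp
  ring

lemma θ_mem_eisSubring : θ ∈ eisSubring := ⟨1, 2, by simp [θ_eq]⟩

lemma zero_mem_thetaE : (0 : ℂ) ∈ thetaE := ⟨0, eisSubring.zero_mem, by simp⟩

lemma θ_mul_mem_of_mem_dualD3 {v : Fin 3 → ℂ} (hv : v ∈ dualD3) : θ * v 0 ∈ eisSubring := by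
  have hw : ![θ, 0, 0] ∈ D3Set := by
    refine ⟨fun i => ?_, 1, eisSubring.one_mem, by simp⟩
    fin_cases i
    · exact θ_mem_eisSubring
    · exact eisSubring.zero_mem
    · exact eisSubring.zero_mem
  have h := eisSubring.neg_mem (mem_eisSubring.2 (hv _ hw))
  simp only [hermStd3, Fin.sum_univ_three] at h
  convert h using 1
  simp only [cons_val_zero, cons_val_one, cons_val, star_θ, star_zero]
  ring

lemma sub_mem_of_mem_dualD3 {v : Fin 3 → ℂ} (hv : v ∈ dualD3) (i : Fin 3) :
    v i - v 0 ∈ eisSubring := by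
  have hw1 : ![-1, 1, 0] ∈ D3Set := by
    refine ⟨fun i => ?_, 0, eisSubring.zero_mem, by simp⟩
    fin_cases i
    · exact eisSubring.neg_mem eisSubring.one_mem
    · exact eisSubring.one_mem
    · exact eisSubring.zero_mem
  have hw2 : ![-1, 0, 1] ∈ D3Set := by
    refine ⟨fun i => ?_, 0, eisSubring.zero_mem, by simp⟩
    fin_cases i
    · exact eisSubring.neg_mem eisSubring.one_mem
    · exact eisSubring.zero_mem
    · exact eisSubring.one_mem
  have h1 := mem_eisSubring.2 (hv _ hw1)
  have h2 := mem_eisSubring.2 (hv _ hw2)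
  simp only [hermStd3, Fin.sum_univ_three] at h1 h2
  fin_cases i
  · simp
  · convert h1 using 1
    simp
    ring
  · convert h2 using 1
    simp
    ring

lemma mem_dualD3_of_mem {s t : ℂ} (hs : s ∈ eisSubring) (ht : t ∈ eisSubring) :
    ![t / θ, t / θ, t / θ + s] ∈ dualD3 := by
  rintro w ⟨hw, y, hy, hsum⟩
  have h : hermStd3 ![t / θ, t / θ, t / θ + s] w = s * star (w 2) - t * star y := by
    have hstar := congrArg star hsum
    rw [star_add, star_add, star_mul', star_θ] at hstar
    simp only [hermStd3, Fin.sum_univ_three, cons_val_zero, cons_val_one, cons_val]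
    have := θ_ne_zero
    field_simp
    linear_combination t * hstar
  rw [h]
  exact eisSubring.sub_mem (eisSubring.mul_mem hs (star_mem_eisSubring (hw 2)))
    (eisSubring.mul_mem ht (star_mem_eisSubring hy))

/-- Writing `v ∈ D₃^∨` as `u + (t / θ)(1, 1, 1)` with `t = θ v₀`, this is the linear map sending
`v` to `(u₀ + u₁ + u₂, t)`. -/
def discMap (v : Fin 3 → ℂ) : Fin 2 → ℂ :=
  ![(v 1 - v 0) + (v 2 - v 0), θ * v 0]

lemma discMap_zero (v : Fin 3 → ℂ) : discMap v 0 = (v 1 - v 0) + (v 2 - v 0) := rfl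

lemma discMap_one (v : Fin 3 → ℂ) : discMap v 1 = θ * v 0 := rfl

lemma discMap_add (v w : Fin 3 → ℂ) : discMap (v + w) = discMap v + discMap w := by
  ext i
  fin_cases i <;> simp [discMap] <;> ring

lemma discMap_smul (e : ℂ) (v : Fin 3 → ℂ) : discMap (e • v) = e • discMap v := by
  ext i
  fin_cases i <;> simp [discMap] <;> ring

lemma discMap_mem_eisSubring {v : Fin 3 → ℂ} (hv : v ∈ dualD3) (i : Fin 2) :
    discMap v i ∈ eisSubring := by
  fin_cases i
  · exact eisSubring.add_mem (sub_mem_of_mem_dualD3 hv 1) (sub_mem_of_mem_dualD3 hv 2)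
  · exact θ_mul_mem_of_mem_dualD3 hv

lemma discMap_mem_thetaE {v : Fin 3 → ℂ} (hv : v ∈ D3Set) (i : Fin 2) :
    discMap v i ∈ thetaE := by
  obtain ⟨hv, y, hy, hsum⟩ := hv
  fin_cases i
  · refine ⟨y + θ * v 0,
      eisSubring.add_mem hy (eisSubring.mul_mem θ_mem_eisSubring (hv 0)), ?_⟩
    change (v 1 - v 0) + (v 2 - v 0) = _
    linear_combination hsum - v 0 * θ_sq
  · exact ⟨v 0, hv 0, rfl⟩

lemma mem_D3Set_of_discMap {v : Fin 3 → ℂ} (hv : v ∈ dualD3)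
    (h : ∀ i, discMap v i ∈ thetaE) : v ∈ D3Set := by
  obtain ⟨y, hy, hs⟩ := h 0
  obtain ⟨z, hz, ht⟩ := h 1
  rw [discMap_zero] at hs
  rw [discMap_one] at ht
  have hv0 : v 0 ∈ eisSubring := by
    rwa [mul_left_cancel₀ θ_ne_zero ht]
  refine ⟨fun i => ?_, y - θ * v 0,
    eisSubring.sub_mem hy (eisSubring.mul_mem θ_mem_eisSubring hv0), ?_⟩
  · simpa [mem_eisSubring] using eisSubring.add_mem (sub_mem_of_mem_dualD3 hv i) hv0
  · linear_combination hs + v 0 * θ_sq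

lemma hermStd3_sub_discMap_mem {v w : Fin 3 → ℂ} (hv : v ∈ dualD3) (hw : w ∈ dualD3) :
    hermStd3 v w - (discMap v 0 * star (discMap w 1) - discMap v 1 * star (discMap w 0)) * θ / 3
      ∈ eisSubring := by
  have h : hermStd3 v w -
      (discMap v 0 * star (discMap w 1) - discMap v 1 * star (discMap w 0)) * θ / 3 =
      (θ * v 0) * star (θ * w 0) + (v 1 - v 0) * star (w 1 - w 0)
        + (v 2 - v 0) * star (w 2 - w 0) := by
    simp only [discMap_zero, discMap_one, hermStd3, Fin.sum_univ_three, star_add, star_sub,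
      star_mul', star_θ]
    linear_combination (v 0 * star (w 0) + ((v 1 - v 0) + (v 2 - v 0)) * star (w 0) / 3
      + v 0 * ((star (w 1) - star (w 0)) + (star (w 2) - star (w 0))) / 3) * θ_sq
  rw [h]
  exact eisSubring.add_mem (eisSubring.add_mem
    (eisSubring.mul_mem (θ_mul_mem_of_mem_dualD3 hv)
      (star_mem_eisSubring (θ_mul_mem_of_mem_dualD3 hw)))
    (eisSubring.mul_mem (sub_mem_of_mem_dualD3 hv 1)
      (star_mem_eisSubring (sub_mem_of_mem_dualD3 hw 1))))
    (eisSubring.mul_mem (sub_mem_of_mem_dualD3 hv 2)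
      (star_mem_eisSubring (sub_mem_of_mem_dualD3 hw 2)))

theorem statement4 :
    ∃ φ : (Fin 3 → ℂ) → (Fin 2 → ℂ),
      (∀ v ∈ dualD3, ∀ i, φ v i ∈ Eis) ∧
      (∀ v ∈ D3Set, ∀ i, φ v i ∈ thetaE) ∧
      (∀ v ∈ dualD3, ∀ w ∈ dualD3, ∀ i, φ (v + w) i - φ v i - φ w i ∈ thetaE) ∧
      (∀ e ∈ Eis, ∀ v ∈ dualD3, ∀ i, φ (e • v) i - e * φ v i ∈ thetaE) ∧
      (∀ a : Fin 2 → ℂ, (∀ i, a i ∈ Eis) → ∃ v ∈ dualD3, ∀ i, φ v i - a i ∈ thetaE) ∧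
      (∀ v ∈ dualD3, (∀ i, φ v i ∈ thetaE) → v ∈ D3Set) ∧
      (∀ v ∈ dualD3, ∀ w ∈ dualD3,
        hermStd3 v w - (φ v 0 * star (φ w 1) - φ v 1 * star (φ w 0)) * θ / 3 ∈ Eis) := by
  refine ⟨discMap, fun v hv => discMap_mem_eisSubring hv, fun v hv => discMap_mem_thetaE hv,
    fun v _ w _ i => ?_, fun e _ v _ i => ?_, fun a ha => ?_,
    fun v hv => mem_D3Set_of_discMap hv, fun v hv w hw => hermStd3_sub_discMap_mem hv hw⟩
  · simpa [discMap_add] using zero_mem_thetaE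
  · simpa [discMap_smul] using zero_mem_thetaE
  · refine ⟨_, mem_dualD3_of_mem (ha 0) (ha 1), fun i => ?_⟩
    have := θ_ne_zero
    convert zero_mem_thetaE using 1
    fin_cases i
    · simp [discMap]
    · simp [discMap]
      field_simp
      ring
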